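/- arXiv:1510.03921 — 3 statements merged into one kernel-verified Lean document; each statement's English description precedes it below -/
import Mathlib

section
/- Let S be a finite set with s_i ∈ S, let t ∉ S, and set S₋ = S \ {s_i} and S₊ = S ∪ {t}. Then the objective before the replacement exceeds the objective after the replacement, i.e. κ̃(S₋ ∪ {s_i}) > κ̃(S₋ ∪ {t}), if and only if the responsibility of s_i in the expanded set exceeds that of t, i.e. rsp_{S₊}(s_i) > rsp_{S₊}(t). -/
open Finset

/-- Optimization objective κ̃(S): the sum of κ over all unordered pairs of
distinct elements of S, encoded as half the sum over ordered distinct pairs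
(these agree since κ is assumed symmetric). -/
noncomputable def obj {X : Type*} [DecidableEq X] (κ : X → X → ℝ) (S : Finset X) : ℝ :=
  (1 / 2) * ∑ p ∈ S.offDiag, κ p.1 p.2

/-- Responsibility of s in S: rsp_S(s) = (1/2) Σ_{j ∈ S, j ≠ s} κ(s, j). -/
noncomputable def rsp {X : Type*} [DecidableEq X] (κ : X → X → ℝ) (S : Finset X) (s : X) : ℝ :=
  (1 / 2) * ∑ j ∈ S.erase s, κ s j

theorem obj_insert_aux {X : Type*} [DecidableEq X] (κ : X → X → ℝ)
    (hsymm : ∀ x y, κ x y = κ y x) (A : Finset X) (a : X) (ha : a ∉ A) :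
    obj κ (insert a A) = obj κ A + ∑ j ∈ A, κ a j := by
  unfold obj
  rw [Finset.offDiag_insert ha, Finset.sum_union, Finset.sum_union, Finset.sum_product,
    Finset.sum_product]
  · simp only [Finset.sum_singleton]
    rw [Finset.sum_congr rfl (fun x _ => hsymm x a)]
    ring
  · rw [Finset.disjoint_left]
    rintro ⟨x, y⟩ h1 h2
    simp only [Finset.mem_offDiag, Finset.mem_product, Finset.mem_singleton] at h1 h2
    exact ha (h2.1 ▸ h1.1)
  · rw [Finset.disjoint_left]
    rintro ⟨x, y⟩ h1 h2
    simp only [Finset.mem_union, Finset.mem_offDiag, Finset.mem_product,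
      Finset.mem_singleton] at h1 h2
    rcases h1 with h1 | h1
    · exact ha (h2.2 ▸ h1.2.1)
    · exact ha (h2.2 ▸ h1.2)

/-- with S₋ = S \ {sᵢ} and S₊ = S ∪ {t},
κ̃(S₋ ∪ {sᵢ}) > κ̃(S₋ ∪ {t}) ↔ rsp_{S₊}(sᵢ) > rsp_{S₊}(t). -/
theorem stmt_0 {X : Type*} [DecidableEq X] (κ : X → X → ℝ)
    (hsymm : ∀ x y, κ x y = κ y x)
    (S : Finset X) (sᵢ t : X) (hsi : sᵢ ∈ S) (ht : t ∉ S) :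
    obj κ (insert sᵢ (S.erase sᵢ)) > obj κ (insert t (S.erase sᵢ)) ↔
      rsp κ (insert t S) sᵢ > rsp κ (insert t S) t := by
  have hne : t ≠ sᵢ := fun h => ht (h ▸ hsi)
  have ht' : t ∉ S.erase sᵢ := fun h => ht (Finset.mem_of_mem_erase h)
  rw [obj_insert_aux κ hsymm _ _ (Finset.notMem_erase sᵢ S), obj_insert_aux κ hsymm _ _ ht']
  unfold rsp
  rw [Finset.erase_insert ht, Finset.erase_insert_of_ne hne, Finset.sum_insert ht',
    ← Finset.add_sum_erase S (fun j => κ t j) hsi, hsymm sᵢ t]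
  constructor <;> intro h <;> linarith
end

section
/- Let S be a finite set, t ∉ S, and S₊ = S ∪ {t} the expanded set. Let x* ∈ S₊ be an element of maximal responsibility in S₊. Then the set S₊ \ {x*} produced by the Expand-then-Shrink step satisfies κ̃(S₊ \ {x*}) ≤ κ̃(S); that is, one Expand/Shrink step of the Interchange algorithm never increases the optimization objective. -/
open Finset

/-- Inserting a new point adds twice its responsibility to the objective. -/
theorem obj_insert_eq {X : Type*} [DecidableEq X] (κ : X → X → ℝ)
    (hsymm : ∀ x y, κ x y = κ y x) (S : Finset X) (x : X) (hx : x ∉ S) :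
    obj κ (insert x S) = obj κ S + 2 * rsp κ (insert x S) x := by
  unfold obj rsp
  rw [Finset.erase_insert hx, Finset.offDiag_insert hx, Finset.sum_union, Finset.sum_union,
    Finset.sum_product, Finset.sum_product]
  · simp only [Finset.sum_singleton]
    rw [Finset.sum_congr rfl (fun y _ => hsymm y x)]
    ring
  · rw [Finset.disjoint_left]
    rintro ⟨a, b⟩ h1 h2
    simp only [Finset.mem_offDiag, Finset.mem_product, Finset.mem_singleton] at h1 h2
    exact hx (h2.1 ▸ h1.1)
  · rw [Finset.disjoint_left]
    rintro ⟨a, b⟩ h1 h2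
    simp only [Finset.mem_union, Finset.mem_offDiag, Finset.mem_product,
      Finset.mem_singleton] at h1 h2
    rcases h1 with h1 | h1
    · exact hx (h2.2 ▸ h1.2.1)
    · exact hx (h1.1 ▸ h2.1)

/-- one Expand/Shrink step never increases the objective. -/
theorem stmt_7 {X : Type*} [DecidableEq X] (κ : X → X → ℝ)
    (hsymm : ∀ x y, κ x y = κ y x)
    (S : Finset X) (t : X) (ht : t ∉ S) (xstar : X)
    (hxstar : xstar ∈ insert t S)
    (hmax : ∀ x ∈ insert t S, rsp κ (insert t S) x ≤ rsp κ (insert t S) xstar) :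
    obj κ ((insert t S).erase xstar) ≤ obj κ S := by
  have h1 := obj_insert_eq κ hsymm S t ht
  have h2 := obj_insert_eq κ hsymm ((insert t S).erase xstar) xstar (Finset.notMem_erase _ _)
  rw [Finset.insert_erase hxstar] at h2
  have h3 := hmax t (Finset.mem_insert_self t S)
  linarith
end

section
/- Let S be a finite set, s_i ∈ S, t ∉ S, and S₊ = S ∪ {t}. If replacing s_i with t strictly reduces the optimization objective, i.e. κ̃(S \ {s_i} ∪ {t}) < κ̃(S), then rsp_{S₊}(s_i) > rsp_{S₊}(t); consequently any element of maximal responsibility in S₊ lies in S (is not t), and removing it yields a set whose objective is at most κ̃(S \ {s_i} ∪ {t}) < κ̃(S). -/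
open Finset

lemma obj_erase_add {X : Type*} [DecidableEq X] (κ : X → X → ℝ)
    (hsymm : ∀ x y, κ x y = κ y x) (T : Finset X) (a : X) (ha : a ∈ T) :
    obj κ T = obj κ (T.erase a) + 2 * rsp κ T a := by
  have key : ∀ A : Finset X, ∑ p ∈ A.offDiag, κ p.1 p.2
      = ∑ x ∈ A, ∑ y ∈ A, κ x y - ∑ x ∈ A, κ x x := by
    intro A
    have h1 : ∑ p ∈ A ×ˢ A, κ p.1 p.2 = ∑ x ∈ A, ∑ y ∈ A, κ x y :=
      Finset.sum_product _ _ _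
    have h2 : ∑ p ∈ A.diag, κ p.1 p.2 = ∑ x ∈ A, κ x x := by
      simp
    rw [← h1, ← h2, ← Finset.diag_union_offDiag,
      Finset.sum_union (Finset.disjoint_diag_offDiag A)]
    ring
  have hT := Finset.insert_erase ha
  have hn : a ∉ T.erase a := Finset.notMem_erase a T
  unfold obj rsp
  generalize T.erase a = A at *
  subst hT
  rw [key, key]
  simp only [Finset.sum_insert hn, Finset.sum_add_distrib]
  have : ∑ x ∈ A, κ x a = ∑ x ∈ A, κ a x := Finset.sum_congr rfl fun x _ => hsymm x a
  rw [this]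
  ring

/-- if replacing sᵢ by t strictly reduces the objective, then
rsp_{S₊}(sᵢ) > rsp_{S₊}(t); hence any element of maximal responsibility in S₊
lies in S, and removing it yields objective ≤ κ̃(S \ {sᵢ} ∪ {t}) < κ̃(S). -/
theorem stmt_9 {X : Type*} [DecidableEq X] (κ : X → X → ℝ)
    (hsymm : ∀ x y, κ x y = κ y x)
    (S : Finset X) (sᵢ t : X) (hsi : sᵢ ∈ S) (ht : t ∉ S)
    (hvalid : obj κ (insert t (S.erase sᵢ)) < obj κ S) :
    rsp κ (insert t S) sᵢ > rsp κ (insert t S) t ∧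
      ∀ xstar ∈ insert t S,
        (∀ x ∈ insert t S, rsp κ (insert t S) x ≤ rsp κ (insert t S) xstar) →
          xstar ∈ S ∧
            obj κ ((insert t S).erase xstar) ≤ obj κ (insert t (S.erase sᵢ)) ∧
            obj κ ((insert t S).erase xstar) < obj κ S := by
  have hne : t ≠ sᵢ := fun h => ht (h ▸ hsi)
  have e1 : (insert t S).erase sᵢ = insert t (S.erase sᵢ) :=
    Finset.erase_insert_of_ne hne
  have e2 : (insert t S).erase t = S := Finset.erase_insert ht
  have h1 := obj_erase_add κ hsymm (insert t S) sᵢ (Finset.mem_insert_of_mem hsi)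
  have h2 := obj_erase_add κ hsymm (insert t S) t (Finset.mem_insert_self t S)
  rw [e1] at h1
  rw [e2] at h2
  have hgt : rsp κ (insert t S) sᵢ > rsp κ (insert t S) t := by linarith
  refine ⟨hgt, fun x hx hmax => ?_⟩
  have h3 := obj_erase_add κ hsymm (insert t S) x hx
  have h4 := hmax sᵢ (Finset.mem_insert_of_mem hsi)
  refine ⟨?_, by linarith, by linarith⟩
  rcases Finset.mem_insert.1 hx with h | h
  · subst h
    linarith
  · exact h
end
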